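/- Let 1 < k < n and let Δ_{n,k} be the path-with-triangle graph on vertices [n+1]. The characteristic polynomial of the connected subgraph arrangement 𝒜_{Δ_{n,k}} is χ(𝒜_{Δ_{n,k}}, t) = (t − 1) · ∏_{i=k+2}^{n+1} (t − i) · ∏_{i=n−k+2}^{n+1} (t − i). -/

import Mathlib

open Finset

/-- The linear form `∑_{i ∈ I} x_i` on `ℚ^n`. -/
noncomputable def linForm {n : ℕ} (I : Finset (Fin n)) : (Fin n → ℚ) →ₗ[ℚ] ℚ :=
  ∑ i ∈ I, LinearMap.proj i

/-- `I` is a nonempty subset of vertices inducing a connected subgraph of `G`. -/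
def ConnSet {n : ℕ} (G : SimpleGraph (Fin n)) (I : Finset (Fin n)) : Prop :=
  I.Nonempty ∧ (G.induce (↑I : Set (Fin n))).Connected

/-- The connected subgraph arrangement of `G`, as a set of hyperplanes of `ℚ^n`. -/
def csa {n : ℕ} (G : SimpleGraph (Fin n)) : Set (Submodule ℚ (Fin n → ℚ)) :=
  {H | ∃ I : Finset (Fin n), ConnSet G I ∧ H = LinearMap.ker (linForm I)}

/-- The almost path graph `A_{n,k}` (paper notation, vertices `1,…,n+1` realized as
`Fin (n+1)` with `0,…,n`): a path `1–⋯–n` together with the edge `{k, n+1}`. -/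
def almostPath (n k : ℕ) : SimpleGraph (Fin (n + 1)) :=
  SimpleGraph.fromRel (fun a b =>
    (a.val + 1 = b.val ∧ b.val < n) ∨ (a.val = k - 1 ∧ b.val = n))

/-- The path-with-triangle graph `Δ_{n,k}` (paper notation): a path `1–⋯–n` together
with the edges `{k, n+1}` and `{k+1, n+1}`. -/
def pathTriangle (n k : ℕ) : SimpleGraph (Fin (n + 1)) :=
  SimpleGraph.fromRel (fun a b =>
    (a.val + 1 = b.val ∧ b.val < n) ∨ (a.val = k - 1 ∧ b.val = n) ∨ (a.val = k ∧ b.val = n))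

/-- The module of `𝒜_G`-derivations `D(𝒜_G) ⊆ Der_ℚ(ℚ[x_1,…,x_n])`. -/
noncomputable def derModule {n : ℕ} (G : SimpleGraph (Fin n)) :
    Submodule (MvPolynomial (Fin n) ℚ)
      (Derivation ℚ (MvPolynomial (Fin n) ℚ) (MvPolynomial (Fin n) ℚ)) where
  carrier := {θ | ∀ I : Finset (Fin n), ConnSet G I →
    (∑ i ∈ I, MvPolynomial.X i) ∣ θ (∑ i ∈ I, MvPolynomial.X i)}
  add_mem' := by
    intro a b ha hb I hI
    rw [Derivation.add_apply]
    exact dvd_add (ha I hI) (hb I hI)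
  zero_mem' := by
    intro I hI
    simp
  smul_mem' := by
    intro c θ hθ I hI
    rw [Derivation.smul_apply, smul_eq_mul]
    exact (hθ I hI).mul_left c

open Classical in
/-- The hyperplanes of the connected subgraph arrangement of `G`, as a `Finset`. -/
noncomputable def csaFinset {n : ℕ} (G : SimpleGraph (Fin n)) :
    Finset (Submodule ℚ (Fin n → ℚ)) :=
  (Finset.univ.filter fun I : Finset (Fin n) => ConnSet G I).image fun I =>
    LinearMap.ker (linForm I)

/-- The characteristic polynomial of a (central) arrangement `A` in `ℚ^n`, via
Whitney's formula `χ(A,t) = ∑_{B ⊆ A} (-1)^{|B|} t^{dim ⋂ B}`, which agrees with the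
Möbius-function definition `χ(A,t) = ∑_{X ∈ L(A)} μ(ℚ^n, X) t^{dim X}`
(Orlik–Terao, Lemma 2.55). -/
noncomputable def charPoly {n : ℕ} (A : Finset (Submodule ℚ (Fin n → ℚ))) : Polynomial ℚ :=
  ∑ B ∈ A.powerset, ((-1 : ℚ) ^ B.card) •
    (Polynomial.X ^ (Module.finrank ℚ ↥(⨅ H ∈ B, H)))


theorem clear_denoms {a b : Type*} [Fintype a] [Fintype b] (M : Matrix a b ℚ) :
    ∃ c : ℤ, c ≠ 0 ∧ ∃ M' : Matrix a b ℤ, M'.map (Int.castRingHom ℚ) = (c : ℚ) • M := by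
  obtain ⟨c, hc⟩ := IsLocalization.exist_integer_multiples_of_finite (nonZeroDivisors ℤ)
    (fun ij : a × b => M ij.1 ij.2)
  choose f hf using hc
  refine ⟨c, nonZeroDivisors.coe_ne_zero c, Matrix.of fun i j => f (i, j), ?_⟩
  ext i j
  have := hf (i, j)
  simpa using this

theorem rank_factor {a b : Type*} [Fintype a] [Fintype b] [DecidableEq a] [DecidableEq b]
    (M : Matrix a b ℚ) (r : ℕ) (hr : M.rank = r) :
    ∃ (C : Matrix a (Fin r) ℚ) (D : Matrix (Fin r) b ℚ)
      (E : Matrix (Fin r) a ℚ) (F : Matrix b (Fin r) ℚ),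
      M = C * D ∧ E * M * F = 1 := by
  let f := M.mulVecLin
  let bas := Module.finBasisOfFinrankEq ℚ (LinearMap.range f) hr
  let e := bas.equivFun
  let d : (b → ℚ) →ₗ[ℚ] (Fin r → ℚ) := e.toLinearMap ∘ₗ f.rangeRestrict
  let c : (Fin r → ℚ) →ₗ[ℚ] (a → ℚ) := (LinearMap.range f).subtype ∘ₗ e.symm.toLinearMap
  have hd : LinearMap.range d = ⊤ := by
    rw [LinearMap.range_eq_top]
    exact e.surjective.comp f.surjective_rangeRestrict
  have hc : LinearMap.ker c = ⊥ := by
    rw [LinearMap.ker_eq_bot]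
    exact (Subtype.val_injective).comp e.symm.injective
  obtain ⟨g, hg⟩ := d.exists_rightInverse_of_surjective hd
  obtain ⟨h, hh⟩ := c.exists_leftInverse_of_injective hc
  have hf : f = c ∘ₗ d := by
    ext x
    simp [c, d]
  have hM : M = LinearMap.toMatrix' c * LinearMap.toMatrix' d := by
    rw [← LinearMap.toMatrix'_comp, ← hf]
    exact (LinearMap.toMatrix'_toLin' M).symm
  refine ⟨LinearMap.toMatrix' c, LinearMap.toMatrix' d, LinearMap.toMatrix' h,
    LinearMap.toMatrix' g, hM, ?_⟩
  conv_lhs => rw [hM]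
  rw [← Matrix.mul_assoc, ← LinearMap.toMatrix'_comp, hh, Matrix.mul_assoc,
    ← LinearMap.toMatrix'_comp, hg]
  simp

theorem rank_mod_p {a b : Type*} [Fintype a] [Fintype b] [DecidableEq a] [DecidableEq b]
    (M : Matrix a b ℤ) :
    ∃ c : ℤ, c ≠ 0 ∧ ∀ (p : ℕ) [Fact p.Prime], ¬ (p : ℤ) ∣ c →
      (M.map (Int.castRingHom (ZMod p))).rank = (M.map (Int.castRingHom ℚ)).rank := by
  obtain ⟨r, hr⟩ : ∃ r, (M.map (Int.castRingHom ℚ)).rank = r := ⟨_, rfl⟩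
  rw [hr]
  obtain ⟨C, D, E, F, h1, h2⟩ := rank_factor (M.map (Int.castRingHom ℚ)) r hr
  obtain ⟨c1, hc1, C', hC⟩ := clear_denoms C
  obtain ⟨c2, hc2, D', hD⟩ := clear_denoms D
  obtain ⟨c3, hc3, E', hE⟩ := clear_denoms E
  obtain ⟨c4, hc4, F', hF⟩ := clear_denoms F
  have inj : Function.Injective (fun X : Matrix a b ℤ => X.map (Int.castRingHom ℚ)) :=
    Matrix.map_injective Int.cast_injective
  have inj' : Function.Injective (fun X : Matrix (Fin r) (Fin r) ℤ => X.map (Int.castRingHom ℚ)) :=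
    Matrix.map_injective Int.cast_injective
  have hsm : ∀ (R : Type) [CommRing R] (m : ℤ),
      (m • (1 : Matrix (Fin r) (Fin r) ℤ)).map (Int.castRingHom R) =
        (m : R) • (1 : Matrix (Fin r) (Fin r) R) := by
    intro R _ m
    ext i j
    rw [Matrix.map_apply, Matrix.smul_apply, Matrix.smul_apply]
    by_cases hij : i = j
    · subst hij; simp
    · simp [Matrix.one_apply_ne hij]
  have hCD : (c1 * c2) • M = C' * D' := by
    apply inj
    have e2 : ((c1 * c2) • M).map (Int.castRingHom ℚ) =
        ((c1 * c2 : ℤ) : ℚ) • M.map (Int.castRingHom ℚ) := by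
      ext; simp
    simp only [e2, Matrix.map_mul, hC, hD]
    rw [h1, Matrix.smul_mul, Matrix.mul_smul, smul_smul]
    simp
  have hEF : E' * M * F' = (c3 * c4) • (1 : Matrix (Fin r) (Fin r) ℤ) := by
    apply inj'
    simp only [hsm, Matrix.map_mul, hE, hF]
    rw [Matrix.smul_mul, Matrix.smul_mul, Matrix.mul_smul, h2, smul_smul]
    simp
  refine ⟨(c1 * c2) * (c3 * c4), by simp [*], fun p _ hp => ?_⟩
  have hp1 : ((c1 * c2 : ℤ) : ZMod p) ≠ 0 := by
    intro h
    rw [ZMod.intCast_zmod_eq_zero_iff_dvd] at h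
    exact hp (h.mul_right _)
  have hp2 : ((c3 * c4 : ℤ) : ZMod p) ≠ 0 := by
    intro h
    rw [ZMod.intCast_zmod_eq_zero_iff_dvd] at h
    exact hp (h.mul_left _)
  apply le_antisymm
  · have e : ((c1 * c2 : ℤ) : ZMod p) • M.map (Int.castRingHom (ZMod p)) =
        C'.map (Int.castRingHom (ZMod p)) * D'.map (Int.castRingHom (ZMod p)) := by
      rw [← Matrix.map_mul, ← hCD]
      ext; simp
    rw [← Matrix.rank_smul_of_mem_nonZeroDivisors _ (mem_nonZeroDivisors_of_ne_zero hp1), e]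
    refine (Matrix.rank_mul_le_left _ _).trans ?_
    exact (Matrix.rank_le_card_width _).trans (by simp)
  · have e : E'.map (Int.castRingHom (ZMod p)) * M.map (Int.castRingHom (ZMod p)) *
        F'.map (Int.castRingHom (ZMod p)) =
          ((c3 * c4 : ℤ) : ZMod p) • (1 : Matrix (Fin r) (Fin r) (ZMod p)) := by
      rw [← Matrix.map_mul, ← Matrix.map_mul, hEF, hsm]
    have e3 : (((c3 * c4 : ℤ) : ZMod p) • (1 : Matrix (Fin r) (Fin r) (ZMod p))).rank = r := by
      rw [Matrix.rank_smul_of_mem_nonZeroDivisors _ (mem_nonZeroDivisors_of_ne_zero hp2)]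
      simp
    rw [← e] at e3
    calc r = _ := e3.symm
      _ ≤ _ := Matrix.rank_mul_le_left _ _
      _ ≤ _ := Matrix.rank_mul_le_right _ _

theorem linForm_apply {N : ℕ} (I : Finset (Fin N)) (x : Fin N → ℚ) :
    linForm I x = ∑ i ∈ I, x i := by
  simp [linForm]

/-- incidence matrix of a family of subsets -/
def incMat {N : ℕ} (S : Finset (Finset (Fin N))) : Matrix S (Fin N) ℤ :=
  fun I j => if j ∈ I.1 then 1 else 0

theorem incMat_mulVec {N : ℕ} (S : Finset (Finset (Fin N))) {R : Type*} [CommRing R]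
    (x : Fin N → R) (I : S) :
    ((incMat S).map (Int.castRingHom R)).mulVec x I = ∑ i ∈ I.1, x i := by
  simp [incMat, Matrix.mulVec, dotProduct, Finset.sum_ite_mem]

theorem flat_card {N : ℕ} (S : Finset (Finset (Fin N))) :
    ∃ c : ℤ, c ≠ 0 ∧ ∀ (p : ℕ) [Fact p.Prime], ¬ (p : ℤ) ∣ c →
      (Finset.univ.filter fun x : Fin N → ZMod p => ∀ I ∈ S, ∑ i ∈ I, x i = 0).card =
        p ^ Module.finrank ℚ ↥(⨅ I ∈ S, LinearMap.ker (linForm I)) := by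
  obtain ⟨c, hc, h⟩ := rank_mod_p (incMat S)
  refine ⟨c, hc, fun p _ hp => ?_⟩
  have hr := h p hp
  have e1 : (⨅ I ∈ S, LinearMap.ker (linForm I)) =
      LinearMap.ker ((incMat S).map (Int.castRingHom ℚ)).mulVecLin := by
    ext x
    simp only [Submodule.mem_iInf, LinearMap.mem_ker, linForm_apply, Matrix.mulVecLin_apply,
      funext_iff, incMat_mulVec, Pi.zero_apply, Subtype.forall]
  have e2 : (Finset.univ.filter fun x : Fin N → ZMod p => ∀ I ∈ S, ∑ i ∈ I, x i = 0).card =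
      Nat.card (LinearMap.ker ((incMat S).map (Int.castRingHom (ZMod p))).mulVecLin) := by
    rw [← Fintype.card_subtype, ← Nat.card_eq_fintype_card]
    apply Nat.card_congr
    apply Equiv.subtypeEquivRight
    intro x
    simp only [LinearMap.mem_ker, Matrix.mulVecLin_apply,
      funext_iff, incMat_mulVec, Pi.zero_apply, Subtype.forall]
  rw [e2, e1, Module.natCard_eq_pow_finrank (K := ZMod p), Nat.card_zmod]
  congr 1
  have r1 := LinearMap.finrank_range_add_finrank_ker
    ((incMat S).map (Int.castRingHom (ZMod p))).mulVecLin
  have r2 := LinearMap.finrank_range_add_finrank_ker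
    ((incMat S).map (Int.castRingHom ℚ)).mulVecLin
  simp only [Module.finrank_fin_fun] at r1 r2
  unfold Matrix.rank at hr
  omega

theorem ker_linForm_injective {N : ℕ} :
    Function.Injective (fun I : Finset (Fin N) => LinearMap.ker (linForm I)) := by
  have key : ∀ I J : Finset (Fin N), LinearMap.ker (linForm I) = LinearMap.ker (linForm J) →
      I ⊆ J := by
    intro I J h i hi
    by_contra hj
    have h1 : (Pi.single i 1 : Fin N → ℚ) ∈ LinearMap.ker (linForm J) := by
      rw [LinearMap.mem_ker, linForm_apply]
      apply Finset.sum_eq_zero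
      intro a ha
      rw [Pi.single_eq_of_ne]
      rintro rfl
      exact hj ha
    rw [← h, LinearMap.mem_ker, linForm_apply] at h1
    simp [Pi.single_apply, hi] at h1
  intro I J h
  exact Finset.Subset.antisymm (key I J h) (key J I h.symm)

open Classical in
theorem charPoly_eval {N : ℕ} (G : SimpleGraph (Fin N)) :
    ∃ c : ℤ, c ≠ 0 ∧ ∀ (p : ℕ) [Fact p.Prime], ¬ (p : ℤ) ∣ c →
      (charPoly (csaFinset G)).eval (p : ℚ) =
        ((Finset.univ.filter fun x : Fin N → ZMod p =>
          ∀ I, ConnSet G I → ∑ i ∈ I, x i ≠ 0).card : ℚ) := by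
  choose c hc h using fun S : Finset (Finset (Fin N)) => flat_card S
  refine ⟨∏ S, c S, Finset.prod_ne_zero_iff.mpr fun S _ => hc S, fun p _ hp => ?_⟩
  have h' : ∀ S : Finset (Finset (Fin N)), _ := fun S => h S p
    (fun hd => hp (hd.trans (Finset.dvd_prod_of_mem c (Finset.mem_univ S))))
  unfold charPoly csaFinset
  set T := Finset.univ.filter fun I : Finset (Fin N) => ConnSet G I with hT
  rw [Finset.powerset_image, Finset.sum_image
    (fun a _ b _ hab => Finset.image_injective ker_linForm_injective hab)]
  simp only [Finset.card_image_of_injective _ ker_linForm_injective]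
  rw [Polynomial.eval_finsetSum]
  have e0 : (Finset.univ.filter fun x : Fin N → ZMod p =>
          ∀ I, ConnSet G I → ∑ i ∈ I, x i ≠ 0) =
      T.inf (fun I => (Finset.univ.filter fun x : Fin N → ZMod p => ∑ i ∈ I, x i = 0)ᶜ) := by
    ext x
    simp [Finset.mem_inf, hT]
  have e1 := Finset.inclusion_exclusion_card_inf_compl T
    (fun I => (Finset.univ.filter fun x : Fin N → ZMod p => ∑ i ∈ I, x i = 0))
  rw [e0]
  have e2 := congrArg (Int.cast : ℤ → ℚ) e1
  rw [Int.cast_natCast] at e2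
  rw [e2, Int.cast_sum]
  apply Finset.sum_congr rfl
  intro S hS
  have e3 : S.inf (fun I => (Finset.univ.filter fun x : Fin N → ZMod p => ∑ i ∈ I, x i = 0)) =
      Finset.univ.filter fun x : Fin N → ZMod p => ∀ I ∈ S, ∑ i ∈ I, x i = 0 := by
    ext x
    simp [Finset.mem_inf]
  rw [e3, h' S, Polynomial.eval_smul, Polynomial.eval_pow, Polynomial.eval_X]
  have e4 : (⨅ H ∈ S.image (fun I => LinearMap.ker (linForm I)), H) =
      ⨅ I ∈ S, LinearMap.ker (linForm I) := by
    exact Finset.iInf_finset_image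
  rw [e4]
  simp

theorem conn_closed {V : Type*} {G : SimpleGraph V} {s : Set V} (h : (G.induce s).Connected)
    (P : V → Prop) (hP : ∀ a ∈ s, ∀ b ∈ s, G.Adj a b → P a → P b) {a b : V} (ha : a ∈ s)
    (hb : b ∈ s) (hPa : P a) : P b := by
  obtain ⟨w⟩ := h.preconnected ⟨a, ha⟩ ⟨b, hb⟩
  have key : ∀ x y : s, (G.induce s).Walk x y → P x → P y := by
    intro x y w
    induction w with
    | nil => exact id
    | cons hadj _ ih => exact fun hx => ih (hP _ (Subtype.property _) _ (Subtype.property _) hadj hx)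
  exact key _ _ w hPa

theorem conn_insert {V : Type*} {G : SimpleGraph V} {s : Set V} (h : (G.induce s).Connected)
    {u v : V} (hu : u ∈ s) (ha : G.Adj u v) : (G.induce (insert v s)).Connected := by
  have := SimpleGraph.connected_induce_union (t := {v}) h.preconnected
    (by rw [SimpleGraph.induce_singleton_eq_top]; exact SimpleGraph.preconnected_top) hu
    (Set.mem_singleton v) ha
  rwa [Set.union_singleton] at this

/-- vertices `i, …, j-1` -/
def ivl (n i j : ℕ) : Finset (Fin (n + 1)) :=
  Finset.univ.filter fun x => i ≤ x.val ∧ x.val < j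

/-- vertices `i, …, j-1` and `n` -/
def ivlz (n i j : ℕ) : Finset (Fin (n + 1)) :=
  Finset.univ.filter fun x => (i ≤ x.val ∧ x.val < j) ∨ x.val = n

theorem mem_ivl {n i j : ℕ} {x : Fin (n + 1)} : x ∈ ivl n i j ↔ i ≤ x.val ∧ x.val < j := by
  simp [ivl]

theorem mem_ivlz {n i j : ℕ} {x : Fin (n + 1)} :
    x ∈ ivlz n i j ↔ (i ≤ x.val ∧ x.val < j) ∨ x.val = n := by
  simp [ivlz]

theorem pT_adj {n k : ℕ} {a b : Fin (n + 1)} : (pathTriangle n k).Adj a b ↔ a ≠ b ∧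
    (((a.val + 1 = b.val ∧ b.val < n) ∨ (a.val = k - 1 ∧ b.val = n) ∨ (a.val = k ∧ b.val = n)) ∨
    ((b.val + 1 = a.val ∧ a.val < n) ∨ (b.val = k - 1 ∧ a.val = n) ∨ (b.val = k ∧ a.val = n))) := by
  simp [pathTriangle, SimpleGraph.fromRel_adj]

theorem conn_singleton {V : Type*} (G : SimpleGraph V) (v : V) : (G.induce {v}).Connected := by
  rw [SimpleGraph.induce_singleton_eq_top]; exact SimpleGraph.connected_top

theorem ivl_conn {n k i d : ℕ} (hd : i + d + 1 ≤ n) :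
    ((pathTriangle n k).induce (↑(ivl n i (i + d + 1)) : Set (Fin (n + 1)))).Connected := by
  induction d with
  | zero =>
    have : (↑(ivl n i (i + 0 + 1)) : Set (Fin (n + 1))) = {⟨i, by omega⟩} := by
      ext x
      simp only [Finset.mem_coe, mem_ivl, Set.mem_singleton_iff, Fin.ext_iff]
      omega
    rw [this]
    exact conn_singleton _ _
  | succ d ih =>
    have : (↑(ivl n i (i + (d + 1) + 1)) : Set (Fin (n + 1))) =
        insert ⟨i + d + 1, by omega⟩ (↑(ivl n i (i + d + 1)) : Set (Fin (n + 1))) := by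
      ext x
      simp only [Finset.mem_coe, mem_ivl, Set.mem_insert_iff, Fin.ext_iff]
      omega
    rw [this]
    refine conn_insert (ih (by omega)) (u := ⟨i + d, by omega⟩) ?_ ?_
    · simp only [Finset.mem_coe, mem_ivl]; omega
    · exact pT_adj.2 ⟨fun h => by rw [Fin.ext_iff] at h; simp only at h; omega,
        Or.inl (Or.inl ⟨rfl, by simp only; omega⟩)⟩

theorem ivlz_conn {n k i j : ℕ} (h1 : 1 < k) (h2 : k < n) (hi : i ≤ k) (hj : k ≤ j) (hn : j ≤ n) :
    ((pathTriangle n k).induce (↑(ivlz n i j) : Set (Fin (n + 1)))).Connected := by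
  by_cases hij : i < j
  · obtain ⟨d, rfl⟩ : ∃ d, j = i + d + 1 := ⟨j - i - 1, by omega⟩
    have : (↑(ivlz n i (i + d + 1)) : Set (Fin (n + 1))) =
        insert ⟨n, by omega⟩ (↑(ivl n i (i + d + 1)) : Set (Fin (n + 1))) := by
      ext x
      simp only [Finset.mem_coe, mem_ivl, mem_ivlz, Set.mem_insert_iff, Fin.ext_iff]
      omega
    rw [this]
    by_cases hik : i = k
    · refine conn_insert (ivl_conn hn) (u := ⟨k, by omega⟩) ?_ ?_
      · simp only [Finset.mem_coe, mem_ivl]; omega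
      · exact pT_adj.2 ⟨fun h => by rw [Fin.ext_iff] at h; simp only at h; omega,
          Or.inl (Or.inr (Or.inr ⟨rfl, rfl⟩))⟩
    · refine conn_insert (ivl_conn hn) (u := ⟨k - 1, by omega⟩) ?_ ?_
      · simp only [Finset.mem_coe, mem_ivl]; omega
      · exact pT_adj.2 ⟨fun h => by rw [Fin.ext_iff] at h; simp only at h; omega,
          Or.inl (Or.inr (Or.inl ⟨rfl, rfl⟩))⟩
  · have : (↑(ivlz n i j) : Set (Fin (n + 1))) = {⟨n, by omega⟩} := by
      ext x
      simp only [Finset.mem_coe, mem_ivlz, Set.mem_singleton_iff, Fin.ext_iff]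
      omega
    rw [this]
    exact conn_singleton _ _

theorem connSet_cases {n k : ℕ} (h1 : 1 < k) (h2 : k < n) {I : Finset (Fin (n + 1))}
    (hI : ConnSet (pathTriangle n k) I) :
    (∃ i j, i < j ∧ j ≤ n ∧ I = ivl n i j) ∨
    (∃ i j, i ≤ k ∧ k ≤ j ∧ j ≤ n ∧ I = ivlz n i j) := by
  obtain ⟨hne, hc⟩ := hI
  by_cases hn : (⟨n, by omega⟩ : Fin (n + 1)) ∈ I
  · right
    obtain ⟨i, hi, hi'⟩ : ∃ i, (i = k ∨ ∃ x ∈ I, x.val < n ∧ i = x.val) ∧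
        ∀ i', (i' = k ∨ ∃ x ∈ I, x.val < n ∧ i' = x.val) → i ≤ i' := by
      classical
      have hex : ∃ i, (i = k ∨ ∃ x ∈ I, x.val < n ∧ i = x.val) := ⟨k, Or.inl rfl⟩
      exact ⟨Nat.find hex, Nat.find_spec hex, fun i' h => Nat.find_min' hex h⟩
    obtain ⟨j, hj, hj'⟩ : ∃ j, (j = k ∨ ∃ x ∈ I, x.val < n ∧ j = x.val + 1) ∧
        ∀ j', (j' = k ∨ ∃ x ∈ I, x.val < n ∧ j' = x.val + 1) → j' ≤ j := by
      have hbd : BddAbove {j | (j = k ∨ ∃ x ∈ I, x.val < n ∧ j = x.val + 1)} := by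
        refine ⟨n, ?_⟩
        rintro j (rfl | ⟨x, _, h, rfl⟩) <;> omega
      exact ⟨sSup {j | (j = k ∨ ∃ x ∈ I, x.val < n ∧ j = x.val + 1)},
        Nat.sSup_mem ⟨k, Or.inl rfl⟩ hbd, fun j' h => le_csSup hbd h⟩
    have hik := hi' k (Or.inl rfl)
    have hjk := hj' k (Or.inl rfl)
    have hjn : j ≤ n := by rcases hj with rfl | ⟨x, _, h, rfl⟩ <;> omega
    refine ⟨i, j, hik, hjk, hjn, ?_⟩
    ext x
    rw [mem_ivlz]
    constructor
    · intro hx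
      by_cases hxn : x.val = n
      · exact Or.inr hxn
      · have hx2 := x.isLt
        have := hi' x.val (Or.inr ⟨x, hx, by omega, rfl⟩)
        have := hj' (x.val + 1) (Or.inr ⟨x, hx, by omega, rfl⟩)
        left; omega
    · rintro (⟨hx1, hx2⟩ | hx)
      · by_contra hxI
        by_cases hxk : x.val < k
        · obtain ⟨y, hy, hyn, rfl⟩ : ∃ y ∈ I, y.val < n ∧ i = y.val := by
            rcases hi with rfl | h
            · omega
            · exact h
          have hyx : y ≠ x := by rintro rfl; exact hxI hy
          have hyx' : y.val ≠ x.val := fun h => hyx (Fin.ext h)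
          have := conn_closed hc (fun v => v.val < x.val) (by
            intro a ha b hb hab hPa
            have hbx : b.val ≠ x.val := fun h => hxI (Fin.ext h ▸ hb)
            rw [pT_adj] at hab
            have := hab.2
            omega) hy hn (by omega)
          simp only at this
          omega
        · obtain ⟨y, hy, hyn, rfl⟩ : ∃ y ∈ I, y.val < n ∧ j = y.val + 1 := by
            rcases hj with rfl | h
            · omega
            · exact h
          have hyx : y ≠ x := by rintro rfl; exact hxI hy
          have hyx' : y.val ≠ x.val := fun h => hyx (Fin.ext h)
          have := conn_closed hc (fun v => x.val < v.val ∧ v.val < n) (by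
            intro a ha b hb hab hPa
            have hbx : b.val ≠ x.val := fun h => hxI (Fin.ext h ▸ hb)
            rw [pT_adj] at hab
            have := hab.2
            omega) hy hn (by omega)
          simp only at this
          omega
      · have : x = ⟨n, by omega⟩ := Fin.ext hx
        rw [this]; exact hn
  · left
    have hlt : ∀ x ∈ I, x.val < n := by
      intro x hx
      have : x.val ≠ n := fun h => hn ((Fin.ext h : x = ⟨n, by omega⟩) ▸ hx)
      omega
    set a := I.min' hne with ha
    set b := I.max' hne with hb
    have haI := I.min'_mem hne
    have hbI := I.max'_mem hne
    rw [← ha] at haI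
    rw [← hb] at hbI
    have hab : a.val ≤ b.val := I.min'_le b hbI
    refine ⟨a.val, b.val + 1, by omega, hlt b hbI, ?_⟩
    ext x
    rw [mem_ivl]
    constructor
    · intro hx
      have e1 : a.val ≤ x.val := I.min'_le x hx
      have e2 : x.val ≤ b.val := I.le_max' x hx
      omega
    · rintro ⟨hx1, hx2⟩
      by_contra hxI
      have hax : a.val ≠ x.val := fun h => hxI (Fin.ext h ▸ haI)
      have hbx : b.val ≠ x.val := fun h => hxI (Fin.ext h ▸ hbI)
      have := conn_closed hc (fun v => v.val < x.val) (by
        intro c hc d hd hcd hPc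
        have hdx : d.val ≠ x.val := fun h => hxI (Fin.ext h ▸ hd)
        have := hlt d hd
        rw [pT_adj] at hcd
        have := hcd.2
        omega) haI hbI (by omega)
      omega

theorem forall_connSet {n k : ℕ} (h1 : 1 < k) (h2 : k < n) (Q : Finset (Fin (n + 1)) → Prop) :
    (∀ I, ConnSet (pathTriangle n k) I → Q I) ↔
      (∀ i j, i < j → j ≤ n → Q (ivl n i j)) ∧
      (∀ i j, i ≤ k → k ≤ j → j ≤ n → Q (ivlz n i j)) := by
  constructor
  · intro h
    refine ⟨fun i j hij hj => h _ ⟨⟨⟨i, by omega⟩, ?_⟩, ?_⟩,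
      fun i j hi hj hn => h _ ⟨⟨⟨n, by omega⟩, ?_⟩, ivlz_conn h1 h2 hi hj hn⟩⟩
    · rw [mem_ivl]; simp only; omega
    · obtain ⟨d, rfl⟩ : ∃ d, j = i + d + 1 := ⟨j - i - 1, by omega⟩
      exact ivl_conn hj
    · rw [mem_ivlz]; simp
  · rintro ⟨ha, hb⟩ I hI
    rcases connSet_cases h1 h2 hI with ⟨i, j, hij, hj, rfl⟩ | ⟨i, j, hi, hj, hn, rfl⟩
    · exact ha i j hij hj
    · exact hb i j hi hj hn

/-- the letter `2` is never followed by the letter `1` -/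
def noBA (x y : Fin 3) : Prop := ¬ (x = 2 ∧ y = 1)

/-- number of occurrences of a letter -/
def cnt {L : ℕ} (c : Fin 3) (w : Fin L → Fin 3) : ℕ :=
  (Finset.univ.filter fun i => w i = c).card

theorem cnt_cons {L : ℕ} (c x : Fin 3) (w : Fin L → Fin 3) :
    cnt c (Fin.cons x w : Fin (L + 1) → Fin 3) = (if x = c then 1 else 0) + cnt c w := by
  unfold cnt
  rw [Fin.card_filter_univ_succ']
  simp

open Classical in
/-- number of admissible words of length `L` with `k` letters `1`, `m` letters `2`, preceded by
the letter `s`. -/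
noncomputable def wordCount (s : Fin 3) (L k m : ℕ) : ℕ :=
  (Finset.univ.filter fun w : Fin L → Fin 3 =>
    List.IsChain noBA (s :: (List.ofFn w ++ [1])) ∧ cnt 1 w = k ∧ cnt 2 w = m).card

theorem wordCount_zero (s : Fin 3) (k m : ℕ) :
    wordCount s 0 k m = if s ≠ 2 ∧ k = 0 ∧ m = 0 then 1 else 0 := by
  classical
  unfold wordCount
  split_ifs with h
  · obtain ⟨h, rfl, rfl⟩ := h
    rw [Finset.filter_true_of_mem]
    · simp
    · intro w _
      simp [cnt, noBA, h]
  · rw [Finset.card_eq_zero, Finset.filter_eq_empty_iff]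
    rintro w _ ⟨h1, h2, h3⟩
    apply h
    simp [cnt] at h2 h3
    simp [noBA] at h1
    exact ⟨h1, h2.symm, h3.symm⟩

theorem wordCount_succ (s : Fin 3) (L k m : ℕ) :
    wordCount s (L + 1) k m = wordCount 0 L k m +
      (if s ≠ 2 ∧ 0 < k then wordCount 1 L (k - 1) m else 0) +
      (if 0 < m then wordCount 2 L k (m - 1) else 0) := by
  classical
  unfold wordCount
  simp only [Finset.card_filter]
  rw [← (Fin.consEquiv (fun _ : Fin (L + 1) => Fin 3)).sum_comp, Fintype.sum_prod_type,
    Fin.sum_univ_three]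
  have key : ∀ x : Fin 3, ∀ w : Fin L → Fin 3,
      (List.IsChain noBA (s :: (List.ofFn (Fin.consEquiv (fun _ : Fin (L + 1) => Fin 3) (x, w))
        ++ [1])) ∧ cnt 1 (Fin.consEquiv (fun _ : Fin (L + 1) => Fin 3) (x, w)) = k ∧
        cnt 2 (Fin.consEquiv (fun _ : Fin (L + 1) => Fin 3) (x, w)) = m) ↔
      (noBA s x ∧ List.IsChain noBA (x :: (List.ofFn w ++ [1])) ∧
        (if x = 1 then 1 else 0) + cnt 1 w = k ∧ (if x = 2 then 1 else 0) + cnt 2 w = m) := by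
    intro x w
    change (List.IsChain noBA (s :: (List.ofFn (Fin.cons x w : Fin (L + 1) → Fin 3) ++ [1])) ∧
      cnt 1 (Fin.cons x w : Fin (L + 1) → Fin 3) = k ∧
      cnt 2 (Fin.cons x w : Fin (L + 1) → Fin 3) = m) ↔ _
    rw [cnt_cons, cnt_cons, List.ofFn_succ]
    simp [List.isChain_cons_cons, and_assoc]
  simp only [key]
  congr 1
  · congr 1
    · refine Finset.sum_congr rfl fun w _ => ?_
      simp [noBA]
    · by_cases h : s ≠ 2 ∧ 0 < k
      · rw [if_pos h]
        have hk := h.2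
        refine Finset.sum_congr rfl fun w _ => ?_
        have : (1 + cnt 1 w = k) ↔ cnt 1 w = k - 1 := by omega
        simp [noBA, h.1, this]
      · rw [if_neg h]
        refine Finset.sum_eq_zero fun w _ => ?_
        rw [if_neg]
        rintro ⟨h1, _, h3, _⟩
        apply h
        simp [noBA] at h1 h3
        exact ⟨h1, by omega⟩
  · by_cases h : 0 < m
    · rw [if_pos h]
      refine Finset.sum_congr rfl fun w _ => ?_
      have : (1 + cnt 2 w = m) ↔ cnt 2 w = m - 1 := by omega
      simp [noBA, this]
    · rw [if_neg h]
      refine Finset.sum_eq_zero fun w _ => ?_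
      rw [if_neg]
      rintro ⟨h1, _, _, h3⟩
      simp at h3
      omega

theorem wordCount_one (L k m : ℕ) : wordCount 1 L k m = wordCount 0 L k m := by
  cases L with
  | zero => simp [wordCount_zero]
  | succ L => simp [wordCount_succ]

theorem wordCount_small (L : ℕ) : ∀ s k m, L < k + m → wordCount s L k m = 0 := by
  induction L with
  | zero => intro s k m h; rw [wordCount_zero, if_neg]; omega
  | succ L ih =>
    intro s k m h
    rw [wordCount_succ, ih _ _ _ (by omega)]
    split_ifs
    all_goals first | rfl | (repeat rw [ih _ _ _ (by omega)])

theorem wordCount_formula (L : ℕ) : ∀ e k m, L = e + k + m →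
    wordCount 0 L k m = (e + 1).multichoose k * e.multichoose m ∧
    wordCount 2 L k m = if e = 0 then 0 else e.multichoose k * e.multichoose m := by
  induction L with
  | zero =>
    intro e k m h
    obtain ⟨rfl, rfl, rfl⟩ : e = 0 ∧ k = 0 ∧ m = 0 := by omega
    simp [wordCount_zero]
  | succ L ih =>
    intro e k m h
    -- the three smaller counts
    have hE : wordCount 0 L k m = if e = 0 then 0 else
        e.multichoose k * (e - 1).multichoose m := by
      split_ifs with he
      · exact wordCount_small _ _ _ _ (by omega)
      · obtain ⟨e, rfl⟩ : ∃ e', e = e' + 1 := ⟨e - 1, by omega⟩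
        simpa using (ih e k m (by omega)).1
    have hA : 0 < k → wordCount 1 L (k - 1) m = (e + 1).multichoose (k - 1) * e.multichoose m :=
      fun hk => by rw [wordCount_one]; exact (ih e (k - 1) m (by omega)).1
    have hB : 0 < m → wordCount 2 L k (m - 1) = if e = 0 then 0 else
        e.multichoose k * e.multichoose (m - 1) :=
      fun hm => (ih e k (m - 1) (by omega)).2
    have h2 : wordCount 2 (L + 1) k m =
        if e = 0 then 0 else e.multichoose k * e.multichoose m := by
      rw [wordCount_succ, hE]
      rcases m with _ | m
      · simp
      · rw [if_pos (Nat.succ_pos m), hB (Nat.succ_pos m)]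
        rcases e with _ | e
        · simp
        · simp [Nat.multichoose_succ_succ e m]; ring
    refine ⟨?_, h2⟩
    have h3 : wordCount 0 (L + 1) k m = wordCount 2 (L + 1) k m +
        (if 0 < k then wordCount 1 L (k - 1) m else 0) := by
      rw [wordCount_succ, wordCount_succ]
      simp; ring
    rw [h3, h2]
    rcases k with _ | k
    · rcases e with _ | e
      · rcases m with _ | m
        · omega
        · simp
      · simp
    · rw [if_pos (Nat.succ_pos k), hA (Nat.succ_pos k)]
      rw [Nat.multichoose_succ_succ e k]
      rcases e with _ | e
      · simp
      · simp; ring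

theorem chain_iff {L : ℕ} (hL : 0 < L) (w : Fin L → Fin 3) (W : Fin (L + 1) → Fin 3)
    (hW : W = Fin.cons 0 w) :
    List.IsChain noBA (2 :: (List.ofFn w ++ [1])) ↔
      (W 1 ≠ 1 ∧ ∀ c, W c = 2 → c + 1 ≠ 0 ∧ W (c + 1) ≠ 1) := by
  have hlen : (2 :: (List.ofFn w ++ [1])).length = L + 2 := by simp
  have hget : ∀ c (h : c < (2 :: (List.ofFn w ++ [1])).length), (2 :: (List.ofFn w ++ [1]))[c] =
      if c = 0 then 2 else if h' : c < L + 1 then W ⟨c, h'⟩ else 1 := by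
    intro c h
    rcases c with _ | c
    · simp
    · simp only [List.getElem_cons_succ, List.getElem_append, List.length_ofFn, List.getElem_ofFn]
      by_cases hc : c < L
      · simp [hc, hW]
        rfl
      · simp [hc]
  rw [List.isChain_iff_getElem]
  simp only [hget, hlen]
  have h1 : (1 : Fin (L + 1)) = ⟨1, by omega⟩ := by
    apply Fin.ext; simp; omega
  have hsucc : ∀ c (h : c + 1 < L + 1), (⟨c, by omega⟩ + 1 : Fin (L + 1)) = ⟨c + 1, h⟩ := by
    intro c h
    apply Fin.ext
    rw [Fin.val_add, h1]
    simp only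
    exact Nat.mod_eq_of_lt h
  have hlast : (⟨L, by omega⟩ + 1 : Fin (L + 1)) = 0 := by
    apply Fin.ext
    rw [Fin.val_add, h1]
    simp
  have h0 : W 0 = 0 := by simp [hW]
  constructor
  · intro h
    refine ⟨?_, ?_⟩
    · have := h 0 (by omega)
      have h' : (1 : ℕ) < L + 1 := by omega
      simp [noBA, hL] at this
      rw [h1]; exact this
    · rintro ⟨c, hc⟩ hWc
      have hc0 : c ≠ 0 := by
        rintro rfl
        have : W 0 = 2 := hWc
        rw [h0] at this
        exact absurd this (by decide)
      have := h c (by omega)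
      by_cases hcL : c + 1 < L + 1
      · rw [hsucc c hcL]
        refine ⟨fun hh => by simp [Fin.ext_iff] at hh, ?_⟩
        have hc' : c < L := by omega
        simp [noBA, hc0, hc, hc', hWc] at this
        exact this
      · have hc' : ¬ c < L := by omega
        simp [noBA, hc0, hc, hc', hWc] at this
  · rintro ⟨ha, hb⟩ i hi
    rcases i with _ | i
    · simp [noBA, hL]
      rw [← h1]; exact ha
    · rintro ⟨e1, e2⟩
      have hi1 : i + 1 < L + 1 := by omega
      simp only [Nat.add_eq_zero_iff, one_ne_zero, and_false, if_false, dif_pos hi1] at e1 e2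
      have := hb _ e1
      by_cases hi2 : i + 1 + 1 < L + 1
      · rw [dif_pos hi2] at e2
        rw [hsucc (i + 1) hi2] at this
        exact this.2 e2
      · obtain rfl : L = i + 1 := by omega
        exact this.1 hlast

theorem wordCount_cyc {L : ℕ} (hL : 0 < L) (k m : ℕ) :
    wordCount 2 L k m = (Finset.univ.filter fun W : Fin (L + 1) → Fin 3 =>
      W 0 = 0 ∧ W 1 ≠ 1 ∧ (∀ c, W c = 2 → c + 1 ≠ 0 ∧ W (c + 1) ≠ 1) ∧
      (Finset.univ.filter fun c => W c = 1).card = k ∧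
      (Finset.univ.filter fun c => W c = 2).card = m).card := by
  classical
  unfold wordCount
  refine Finset.card_bij (fun w _ => Fin.cons 0 w) ?_ ?_ ?_
  · intro w hw
    simp only [Finset.mem_filter, Finset.mem_univ, true_and] at hw ⊢
    obtain ⟨h1, h2, h3⟩ := hw
    rw [chain_iff hL w _ rfl] at h1
    have e1 := cnt_cons 1 0 w
    have e2 := cnt_cons 2 0 w
    simp only [Fin.reduceEq, if_false, zero_add] at e1 e2
    exact ⟨by simp, h1.1, h1.2, e1.trans h2, e2.trans h3⟩
  · intro a _ b _ h
    exact Fin.cons_right_injective (α := fun _ => Fin 3) _ h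
  · intro W hW
    simp only [Finset.mem_filter, Finset.mem_univ, true_and] at hW
    obtain ⟨h0, h1, h2, h3, h4⟩ := hW
    have hWe : W = Fin.cons 0 (Fin.tail W) := by
      conv_lhs => rw [← Fin.cons_self_tail W, h0]
    refine ⟨Fin.tail W, ?_, hWe.symm⟩
    simp only [Finset.mem_filter, Finset.mem_univ, true_and]
    have e1 := cnt_cons 1 0 (Fin.tail W)
    have e2 := cnt_cons 2 0 (Fin.tail W)
    simp only [Fin.reduceEq, if_false, zero_add] at e1 e2
    rw [← hWe] at e1 e2
    exact ⟨(chain_iff hL _ W hWe).2 ⟨h1, h2⟩, e1.symm.trans h3, e2.symm.trans h4⟩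

theorem card_inj {F : Type*} [Fintype F] [DecidableEq F] (S : Finset F) (k : ℕ) (hS : S.card = k) :
    (Finset.univ.filter fun u : Fin k → F => Function.Injective u ∧ ∀ i, u i ∈ S).card =
      k.factorial := by
  have : Fintype.card (Fin k ↪ S) = k.factorial := by
    rw [Fintype.card_embedding_eq]
    simp [hS, Nat.descFactorial_self]
  rw [← this, ← Fintype.card_subtype]
  exact Fintype.card_congr
    { toFun := fun u => ⟨fun i => ⟨u.1 i, u.2.2 i⟩, fun a b h => u.2.1 (by simpa using h)⟩
      invFun := fun e => ⟨fun i => (e i).1, fun a b h => e.injective (Subtype.ext h),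
        fun i => (e i).2⟩
      left_inv := fun u => rfl
      right_inv := fun e => rfl }

open Classical in
theorem labelled_count {F : Type*} [Fintype F] (z : F) (nx : F → F) (k m : ℕ) :
    (Finset.univ.filter fun uv : (Fin k → F) × (Fin m → F) =>
      Function.Injective uv.1 ∧ Function.Injective uv.2 ∧
      (∀ i, uv.1 i ≠ z ∧ uv.1 i ≠ nx z) ∧ (∀ j, uv.2 j ≠ z ∧ nx (uv.2 j) ≠ z) ∧
      (∀ i j, uv.1 i ≠ uv.2 j ∧ uv.1 i ≠ nx (uv.2 j))).card =
    k.factorial * m.factorial * (Finset.univ.filter fun W : F → Fin 3 =>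
      W z = 0 ∧ W (nx z) ≠ 1 ∧ (∀ c, W c = 2 → nx c ≠ z ∧ W (nx c) ≠ 1) ∧
      (Finset.univ.filter fun c => W c = 1).card = k ∧
      (Finset.univ.filter fun c => W c = 2).card = m).card := by
  set Ws := (Finset.univ.filter fun W : F → Fin 3 =>
      W z = 0 ∧ W (nx z) ≠ 1 ∧ (∀ c, W c = 2 → nx c ≠ z ∧ W (nx c) ≠ 1) ∧
      (Finset.univ.filter fun c => W c = 1).card = k ∧
      (Finset.univ.filter fun c => W c = 2).card = m) with hWs
  let φ : (Fin k → F) × (Fin m → F) → (F → Fin 3) := fun uv c =>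
    if ∃ i, uv.1 i = c then 1 else if ∃ j, uv.2 j = c then 2 else 0
  have φ1 : ∀ uv c, φ uv c = 1 ↔ ∃ i, uv.1 i = c := by
    intro uv c
    simp only [φ]
    split_ifs <;> simp_all
  have φ2 : ∀ uv c, φ uv c = 2 ↔ (¬ ∃ i, uv.1 i = c) ∧ ∃ j, uv.2 j = c := by
    intro uv c
    simp only [φ]
    split_ifs <;> simp_all
  have φ0 : ∀ uv c, φ uv c = 0 ↔ (¬ ∃ i, uv.1 i = c) ∧ ¬ ∃ j, uv.2 j = c := by
    intro uv c
    simp only [φ]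
    split_ifs <;> simp_all
  rw [Finset.card_eq_sum_card_fiberwise (f := φ) (t := Ws)]
  · rw [mul_comm, ← smul_eq_mul, ← Finset.sum_const]
    refine Finset.sum_congr rfl fun W hW => ?_
    simp only [hWs, Finset.mem_filter, Finset.mem_univ, true_and] at hW
    obtain ⟨h0, h1, h2, h3, h4⟩ := hW
    rw [← card_inj _ k h3, ← card_inj _ m h4, ← Finset.card_product]
    congr 1
    ext ⟨u, v⟩
    simp only [Finset.mem_filter, Finset.mem_univ, true_and, Finset.mem_product]
    constructor
    · rintro ⟨⟨hu, hv, _, _, huv⟩, rfl⟩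
      refine ⟨⟨hu, fun i => (φ1 _ _).2 ⟨i, rfl⟩⟩, hv, fun j => (φ2 _ _).2 ⟨?_, j, rfl⟩⟩
      rintro ⟨i, hi⟩
      exact (huv i j).1 hi
    · rintro ⟨⟨hu, hu1⟩, hv, hv2⟩
      have su : ∀ c, W c = 1 → ∃ i, u i = c := by
        intro c hc
        have : Finset.univ.image u = Finset.univ.filter fun c => W c = 1 := by
          apply Finset.eq_of_subset_of_card_le
          · intro x hx
            obtain ⟨i, _, rfl⟩ := Finset.mem_image.1 hx
            simpa using hu1 i
          · rw [h3, Finset.card_image_of_injective _ hu]; simp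
        have hc' : c ∈ Finset.univ.image u := by rw [this]; simpa using hc
        simpa using hc'
      have sv : ∀ c, W c = 2 → ∃ i, v i = c := by
        intro c hc
        have : Finset.univ.image v = Finset.univ.filter fun c => W c = 2 := by
          apply Finset.eq_of_subset_of_card_le
          · intro x hx
            obtain ⟨i, _, rfl⟩ := Finset.mem_image.1 hx
            simpa using hv2 i
          · rw [h4, Finset.card_image_of_injective _ hv]; simp
        have hc' : c ∈ Finset.univ.image v := by rw [this]; simpa using hc
        simpa using hc'
      refine ⟨⟨hu, hv, fun i => ⟨?_, ?_⟩, fun j => ⟨?_, (h2 _ (hv2 j)).1⟩, fun i j => ⟨?_, ?_⟩⟩, ?_⟩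
      · intro h; have := hu1 i; rw [h, h0] at this; exact absurd this (by decide)
      · intro h; have := hu1 i; rw [h] at this; exact h1 this
      · intro h; have := hv2 j; rw [h, h0] at this; exact absurd this (by decide)
      · intro h; have := hu1 i; rw [h, hv2 j] at this; exact absurd this (by decide)
      · intro h; have := hu1 i; rw [h] at this; exact (h2 _ (hv2 j)).2 this
      · funext c
        have hcases : ∀ x : Fin 3, x = 0 ∨ x = 1 ∨ x = 2 := by decide
        rcases hcases (W c) with h | h | h
        · rw [h, φ0]
          refine ⟨?_, ?_⟩
          · rintro ⟨i, rfl⟩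
            have := hu1 i; rw [h] at this; exact absurd this (by decide)
          · rintro ⟨i, rfl⟩
            have := hv2 i; rw [h] at this; exact absurd this (by decide)
        · rw [h, φ1]; exact su c h
        · rw [h, φ2]
          refine ⟨?_, sv c h⟩
          rintro ⟨i, rfl⟩
          have := hu1 i; rw [h] at this; exact absurd this (by decide)
  · rintro ⟨u, v⟩ huv
    simp only [Finset.coe_filter, Finset.mem_univ, true_and, Set.mem_ofPred_eq] at huv
    obtain ⟨hu, hv, huz, hvz, huv⟩ := huv
    simp only [hWs, Finset.coe_filter, Finset.mem_univ, true_and, Set.mem_ofPred_eq]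
    refine ⟨(φ0 _ _).2 ⟨?_, ?_⟩, ?_, ?_, ?_, ?_⟩
    · rintro ⟨i, hi⟩; exact (huz i).1 hi
    · rintro ⟨i, hi⟩; exact (hvz i).1 hi
    · rw [Ne, φ1]; rintro ⟨i, hi⟩; exact (huz i).2 hi
    · intro c hc
      rw [φ2] at hc
      obtain ⟨_, j, rfl⟩ := hc
      refine ⟨(hvz j).2, ?_⟩
      rw [Ne, φ1]; rintro ⟨i, hi⟩; exact (huv i j).2 hi
    · have : (Finset.univ.filter fun c => φ (u, v) c = 1) = Finset.univ.image u := by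
        ext c; simp [φ1]
      rw [this, Finset.card_image_of_injective _ hu]; simp
    · have : (Finset.univ.filter fun c => φ (u, v) c = 2) = Finset.univ.image v := by
        ext c
        simp only [Finset.mem_filter, Finset.mem_univ, true_and, Finset.mem_image, φ2]
        constructor
        · rintro ⟨_, h⟩; exact h
        · rintro ⟨j, rfl⟩
          exact ⟨by rintro ⟨i, hi⟩; exact (huv i j).1 hi, j, rfl⟩
      rw [this, Finset.card_image_of_injective _ hv]; simp

open Classical in
theorem labelled_zmod {L : ℕ} (hL : 0 < L) (k m e : ℕ) (he : 0 < e) (h : L = e + k + m) :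
    (Finset.univ.filter fun uv : (Fin k → ZMod (L + 1)) × (Fin m → ZMod (L + 1)) =>
      Function.Injective uv.1 ∧ Function.Injective uv.2 ∧
      (∀ i, uv.1 i ≠ 0 ∧ uv.1 i ≠ 0 + 1) ∧ (∀ j, uv.2 j ≠ 0 ∧ uv.2 j + 1 ≠ 0) ∧
      (∀ i j, uv.1 i ≠ uv.2 j ∧ uv.1 i ≠ uv.2 j + 1)).card =
    (k.factorial * e.multichoose k) * (m.factorial * e.multichoose m) := by
  have h1 := labelled_count (F := ZMod (L + 1)) 0 (fun c => c + 1) k m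
  have h2 := (wordCount_formula L e k m h).2
  rw [if_neg (by omega), wordCount_cyc hL] at h2
  refine (Eq.trans ?_ h1).trans ?_
  · congr!
  · have : (Finset.univ.filter fun W : ZMod (L + 1) → Fin 3 =>
      W 0 = 0 ∧ W (0 + 1) ≠ 1 ∧ (∀ c, W c = 2 → c + 1 ≠ 0 ∧ W (c + 1) ≠ 1) ∧
      (Finset.univ.filter fun c => W c = 1).card = k ∧
      (Finset.univ.filter fun c => W c = 2).card = m).card =
        e.multichoose k * e.multichoose m := by
      rw [← h2]
      let ε : Fin (L + 1) ≃+* ZMod (L + 1) := ZMod.finEquiv (L + 1)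
      have hc : ∀ (W : ZMod (L + 1) → Fin 3) (a : Fin 3),
          (Finset.univ.filter fun c => W (ε c) = a).card =
          (Finset.univ.filter fun c => W c = a).card := by
        intro W a
        refine Finset.card_bij (fun c _ => ε c) ?_ ?_ ?_
        · intro c hc; simpa using hc
        · intro c _ d _ hcd; exact ε.injective hcd
        · intro c hc
          exact ⟨ε.symm c, by simpa using hc, by simp⟩
      refine Finset.card_bij (fun W _ c => W (ε c)) ?_ ?_ ?_
      · intro W hW
        simp only [Finset.mem_filter, Finset.mem_univ, true_and, zero_add] at hW ⊢
        obtain ⟨a1, a2, a3, a4, a5⟩ := hW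
        refine ⟨by rw [map_zero]; exact a1, by rw [map_one]; exact a2, ?_,
          (hc W 1).trans a4, (hc W 2).trans a5⟩
        intro c h
        have := a3 _ h
        rw [map_add, map_one]
        refine ⟨fun h0 => this.1 ?_, this.2⟩
        rw [← map_one ε, ← map_add, h0, map_zero]
      · intro W _ W' _ hWW
        funext c
        have := congrFun hWW (ε.symm c)
        simpa using this
      · intro W hW
        refine ⟨fun c => W (ε.symm c), ?_, by funext c; simp⟩
        have hc1 := hc (fun c => W (ε.symm c)) 1
        have hc2 := hc (fun c => W (ε.symm c)) 2
        simp only [RingEquiv.symm_apply_apply] at hc1 hc2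
        simp only [Finset.mem_filter, Finset.mem_univ, true_and, zero_add] at hW ⊢
        obtain ⟨a1, a2, a3, a4, a5⟩ := hW
        refine ⟨by rw [map_zero]; exact a1, by rw [map_one]; exact a2, ?_,
          hc1.symm.trans a4, hc2.symm.trans a5⟩
        intro c h
        have := a3 _ h
        rw [map_add, map_one]
        refine ⟨fun h0 => this.1 ?_, this.2⟩
        rw [← map_one ε.symm, ← map_add, h0, map_zero]
    refine Eq.trans (b := k.factorial * m.factorial * (e.multichoose k * e.multichoose m)) ?_
      (by ring)
    rw [← this]
    congr!

/-- positions on the line: `u`, then `0` at index `k`, then `v` -/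
def posn {F : Type*} [Zero F] {k m : ℕ} (u : Fin k → F) (v : Fin m → F) (i : ℕ) : F :=
  if h : i < k then u ⟨i, h⟩ else if h : k < i ∧ i - k - 1 < m then v ⟨i - k - 1, h.2⟩ else 0

theorem posn_lt {F : Type*} [Zero F] {k m : ℕ} (u : Fin k → F) (v : Fin m → F) (i : Fin k) :
    posn u v i.val = u i := by
  simp [posn]

theorem posn_self {F : Type*} [Zero F] {k m : ℕ} (u : Fin k → F) (v : Fin m → F) :
    posn u v k = 0 := by
  simp [posn]

theorem posn_gt {F : Type*} [Zero F] {k m : ℕ} (u : Fin k → F) (v : Fin m → F) (j : Fin m) :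
    posn u v (k + 1 + j.val) = v j := by
  have h1 : ¬ (k + 1 + j.val < k) := by omega
  have h2 : k + 1 + j.val - k - 1 = j.val := by omega
  have h3 : k < k + 1 + j.val ∧ k + 1 + j.val - k - 1 < m := ⟨by omega, by omega⟩
  unfold posn
  rw [dif_neg h1, dif_pos h3]
  congr 1
  exact Fin.ext h2

/-- the point with given positions -/
def psi {F : Type*} [CommRing F] (n : ℕ) (z : F) (Y : ℕ → F) (c : Fin (n + 1)) : F :=
  if c.val < n then z * (Y (c.val + 1) - Y c.val) else z

theorem sum_ivl_self {F : Type*} [AddCommMonoid F] (n i : ℕ) (x : Fin (n + 1) → F) :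
    ∑ c ∈ ivl n i i, x c = 0 := by
  have : ivl n i i = ∅ := by
    ext c; simp only [mem_ivl, Finset.notMem_empty, iff_false]; omega
  rw [this, Finset.sum_empty]

theorem sum_ivl_succ {F : Type*} [AddCommMonoid F] {n i j : ℕ} (hij : i ≤ j) (hj : j < n)
    (x : Fin (n + 1) → F) :
    ∑ c ∈ ivl n i (j + 1), x c = x ⟨j, by omega⟩ + ∑ c ∈ ivl n i j, x c := by
  have : ivl n i (j + 1) = insert ⟨j, by omega⟩ (ivl n i j) := by
    ext c
    simp only [mem_ivl, Finset.mem_insert, Fin.ext_iff]; omega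
  rw [this, Finset.sum_insert]
  simp [mem_ivl]

theorem sum_ivl_succ_left {F : Type*} [AddCommMonoid F] {n i j : ℕ} (hij : i < j) (hj : j ≤ n)
    (x : Fin (n + 1) → F) :
    ∑ c ∈ ivl n i j, x c = x ⟨i, by omega⟩ + ∑ c ∈ ivl n (i + 1) j, x c := by
  have : ivl n i j = insert ⟨i, by omega⟩ (ivl n (i + 1) j) := by
    ext c
    simp only [mem_ivl, Finset.mem_insert, Fin.ext_iff]; omega
  rw [this, Finset.sum_insert]
  simp [mem_ivl]

theorem sum_ivlz {F : Type*} [AddCommMonoid F] {n i j : ℕ} (hj : j ≤ n)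
    (x : Fin (n + 1) → F) :
    ∑ c ∈ ivlz n i j, x c = x ⟨n, by omega⟩ + ∑ c ∈ ivl n i j, x c := by
  have : ivlz n i j = insert ⟨n, by omega⟩ (ivl n i j) := by
    ext c
    simp only [mem_ivl, mem_ivlz, Finset.mem_insert, Fin.ext_iff]; omega
  rw [this, Finset.sum_insert]
  simp only [mem_ivl]; omega

theorem psi_sum {F : Type*} [CommRing F] {n : ℕ} (z : F) (Y : ℕ → F) {i j : ℕ} (hij : i ≤ j)
    (hj : j ≤ n) : ∑ c ∈ ivl n i j, psi n z Y c = z * (Y j - Y i) := by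
  induction j, hij using Nat.le_induction with
  | base => rw [sum_ivl_self]; ring
  | succ j hij ih =>
    rw [sum_ivl_succ hij (by omega), ih (by omega)]
    have : psi n z Y ⟨j, by omega⟩ = z * (Y (j + 1) - Y j) := by
      unfold psi; rw [if_pos (by simpa using hj)]
    rw [this]; ring

theorem psi_last {F : Type*} [CommRing F] {n : ℕ} (z : F) (Y : ℕ → F) :
    psi n z Y ⟨n, by omega⟩ = z := by
  simp [psi]

theorem psi_good {F : Type*} [Field F] {n k : ℕ} (h1 : 1 < k) (h2 : k < n) (z : F) (Y : ℕ → F) :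
    (∀ I, ConnSet (pathTriangle n k) I → ∑ i ∈ I, psi n z Y i ≠ 0) ↔
      z ≠ 0 ∧ (∀ i j, i < j → j ≤ n → Y i ≠ Y j) ∧
      (∀ i j, i ≤ k → k ≤ j → j ≤ n → Y i ≠ Y j + 1) := by
  rw [forall_connSet h1 h2 (fun I => ∑ i ∈ I, psi n z Y i ≠ 0)]
  constructor
  · rintro ⟨ha, hb⟩
    refine ⟨?_, ?_, ?_⟩
    · have := hb k k le_rfl le_rfl h2.le
      rw [sum_ivlz h2.le, sum_ivl_self, psi_last, add_zero] at this
      exact this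
    · intro i j hij hj h
      have := ha i j hij hj
      rw [psi_sum z Y hij.le hj, h] at this
      simp at this
    · intro i j hi hj hn h
      have := hb i j hi hj hn
      rw [sum_ivlz hn, psi_sum z Y (by omega) hn, psi_last, h] at this
      apply this; ring
  · rintro ⟨hz, ha, hb⟩
    refine ⟨?_, ?_⟩
    · intro i j hij hj
      rw [psi_sum z Y hij.le hj]
      exact mul_ne_zero hz (sub_ne_zero.2 (ha i j hij hj).symm)
    · intro i j hi hj hn
      rw [sum_ivlz hn, psi_sum z Y (by omega) hn, psi_last]
      have : z + z * (Y j - Y i) = z * (Y j + 1 - Y i) := by ring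
      rw [this]
      exact mul_ne_zero hz (sub_ne_zero.2 (hb i j hi hj hn).symm)

theorem idx_cases {k m i : ℕ} (h : i ≤ k + m) :
    (∃ a : Fin k, i = a.val) ∨ i = k ∨ (∃ b : Fin m, i = k + 1 + b.val) := by
  rcases lt_trichotomy i k with h1 | h1 | h1
  · exact Or.inl ⟨⟨i, h1⟩, rfl⟩
  · exact Or.inr (Or.inl h1)
  · refine Or.inr (Or.inr ⟨⟨i - k - 1, by omega⟩, ?_⟩)
    simp only; omega

theorem posn_good {F : Type*} [Field F] {k m : ℕ} (u : Fin k → F) (v : Fin m → F) :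
    ((∀ i j, i < j → j ≤ k + m → posn u v i ≠ posn u v j) ∧
      (∀ i j, i ≤ k → k ≤ j → j ≤ k + m → posn u v i ≠ posn u v j + 1)) ↔
      (Function.Injective u ∧ Function.Injective v ∧
      (∀ i, u i ≠ 0 ∧ u i ≠ 0 + 1) ∧ (∀ j, v j ≠ 0 ∧ v j + 1 ≠ 0) ∧
      (∀ i j, u i ≠ v j ∧ u i ≠ v j + 1)) := by
  constructor
  · rintro ⟨ha, hb⟩
    refine ⟨?_, ?_, ?_, ?_, ?_⟩
    · intro i j hij
      rcases lt_trichotomy i j with h | h | h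
      · have := ha i j h (by omega)
        rw [posn_lt, posn_lt] at this; exact absurd hij this
      · exact h
      · have := ha j i h (by omega)
        rw [posn_lt, posn_lt] at this; exact absurd hij.symm this
    · intro i j hij
      rcases lt_trichotomy i j with h | h | h
      · have := ha (k + 1 + i) (k + 1 + j) (by omega) (by omega)
        rw [posn_gt, posn_gt] at this; exact absurd hij this
      · exact h
      · have := ha (k + 1 + j) (k + 1 + i) (by omega) (by omega)
        rw [posn_gt, posn_gt] at this; exact absurd hij.symm this
    · intro i
      have a1 := ha i k i.2 (by omega)
      have a2 := hb i k i.2.le le_rfl (by omega)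
      rw [posn_lt, posn_self] at a1 a2
      exact ⟨a1, a2⟩
    · intro j
      have a1 := ha k (k + 1 + j) (by omega) (by omega)
      have a2 := hb k (k + 1 + j) le_rfl (by omega) (by omega)
      rw [posn_gt, posn_self] at a1 a2
      exact ⟨a1.symm, a2.symm⟩
    · intro i j
      have a1 := ha i (k + 1 + j) (by omega) (by omega)
      have a2 := hb i (k + 1 + j) (by omega) (by omega) (by omega)
      rw [posn_gt, posn_lt] at a1 a2
      exact ⟨a1, a2⟩
  · rintro ⟨hu, hv, hu0, hv0, huv⟩
    refine ⟨?_, ?_⟩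
    · intro i j hij hj
      rcases idx_cases (hij.le.trans hj) with ⟨a, rfl⟩ | rfl | ⟨a, rfl⟩ <;>
      rcases idx_cases hj with ⟨b, rfl⟩ | rfl | ⟨b, rfl⟩ <;>
      (try omega) <;> simp only [posn_lt, posn_gt, posn_self]
      · intro h; have := hu h; omega
      · exact (hu0 a).1
      · exact (huv a b).1
      · exact (hv0 b).1.symm
      · intro h; have := hv h; omega
    · intro i j hi hj hn
      rcases idx_cases (hi.trans (hj.trans hn)) with ⟨a, rfl⟩ | rfl | ⟨a, rfl⟩ <;>
      rcases idx_cases hn with ⟨b, rfl⟩ | rfl | ⟨b, rfl⟩ <;>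
      (try omega) <;> simp only [posn_lt, posn_gt, posn_self]
      · exact (hu0 a).2
      · exact (huv a b).2
      · simp
      · exact (hv0 b).2.symm

theorem exists_posn {F : Type*} [Field F] {k m : ℕ} (x : Fin (k + m + 1) → F)
    (hz : x ⟨k + m, by omega⟩ ≠ 0) :
    ∃ (u : Fin k → F) (v : Fin m → F), psi (k + m) (x ⟨k + m, by omega⟩) (posn u v) = x := by
  set z := x ⟨k + m, by omega⟩ with hzd
  refine ⟨fun i => -(∑ c ∈ ivl (k + m) i k, x c) / z,
    fun j => (∑ c ∈ ivl (k + m) k (k + 1 + j), x c) / z, ?_⟩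
  set Y := posn (fun i : Fin k => -(∑ c ∈ ivl (k + m) i k, x c) / z)
    (fun j : Fin m => (∑ c ∈ ivl (k + m) k (k + 1 + j), x c) / z) with hY
  have Y1 : ∀ i, i ≤ k → Y i = -(∑ c ∈ ivl (k + m) i k, x c) / z := by
    intro i hi
    rcases hi.lt_or_eq with h | rfl
    · exact posn_lt _ _ ⟨i, h⟩
    · rw [hY, posn_self, sum_ivl_self]; simp
  have Y2 : ∀ i, k ≤ i → i ≤ k + m → Y i = (∑ c ∈ ivl (k + m) k i, x c) / z := by
    intro i hi hi2
    rcases hi.lt_or_eq with h | rfl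
    · obtain ⟨d, rfl⟩ : ∃ d, i = k + 1 + d := ⟨i - k - 1, by omega⟩
      exact posn_gt _ _ ⟨d, by omega⟩
    · rw [hY, posn_self, sum_ivl_self]; simp
  funext c
  unfold psi
  by_cases hc : c.val < k + m
  · rw [if_pos hc]
    by_cases hck : c.val < k
    · rw [Y1 c (by omega), Y1 (c + 1) (by omega), sum_ivl_succ_left hck (by omega)]
      field_simp
      ring
    · rw [Y2 c (by omega) (by omega), Y2 (c + 1) (by omega) (by omega),
        sum_ivl_succ (by omega) hc]
      field_simp
      ring
  · rw [if_neg hc, hzd]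
    congr 1
    apply Fin.ext
    simp only; omega

theorem psi_inj {F : Type*} [Field F] {k m : ℕ} {z z' : F} {u u' : Fin k → F} {v v' : Fin m → F}
    (hz : z ≠ 0) (h : psi (k + m) z (posn u v) = psi (k + m) z' (posn u' v')) :
    z = z' ∧ u = u' ∧ v = v' := by
  have e1 : z = z' := by
    have := congrFun h ⟨k + m, by omega⟩
    rwa [psi_last, psi_last] at this
  subst e1
  have key : ∀ i j, i ≤ j → j ≤ k + m →
      posn u v j - posn u v i = posn u' v' j - posn u' v' i := by
    intro i j hij hj
    have a := psi_sum (n := k + m) z (posn u v) hij hj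
    rw [h, psi_sum z _ hij hj] at a
    exact (mul_left_cancel₀ hz a).symm
  refine ⟨rfl, ?_, ?_⟩
  · funext i
    have := key i k i.2.le (by omega)
    rw [posn_self, posn_self, posn_lt, posn_lt] at this
    simpa using this
  · funext j
    have := key k (k + 1 + j) (by omega) (by omega)
    rw [posn_self, posn_self, posn_gt, posn_gt] at this
    simpa using this

open Classical in
theorem point_count {F : Type*} [Field F] [Fintype F] {k m : ℕ} (h1 : 1 < k) (h2 : 0 < m) :
    (Finset.univ.filter fun x : Fin (k + m + 1) → F =>
      ∀ I, ConnSet (pathTriangle (k + m) k) I → ∑ i ∈ I, x i ≠ 0).card =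
    (Fintype.card F - 1) *
    (Finset.univ.filter fun uv : (Fin k → F) × (Fin m → F) =>
      Function.Injective uv.1 ∧ Function.Injective uv.2 ∧
      (∀ i, uv.1 i ≠ 0 ∧ uv.1 i ≠ 0 + 1) ∧ (∀ j, uv.2 j ≠ 0 ∧ uv.2 j + 1 ≠ 0) ∧
      (∀ i j, uv.1 i ≠ uv.2 j ∧ uv.1 i ≠ uv.2 j + 1)).card := by
  have hF : Fintype.card F - 1 = ((Finset.univ : Finset F).erase 0).card := by
    rw [Finset.card_erase_of_mem (Finset.mem_univ _), Finset.card_univ]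
  rw [hF, ← Finset.card_product]
  symm
  have good : ∀ (z : F) (u : Fin k → F) (v : Fin m → F), _ := fun z u v =>
    psi_good (n := k + m) h1 (by omega) z (posn u v)
  refine Finset.card_bij (fun a _ => psi (k + m) a.1 (posn a.2.1 a.2.2)) ?_ ?_ ?_
  · rintro ⟨z, u, v⟩ ha
    simp only [Finset.mem_product, Finset.mem_erase, Finset.mem_univ, and_true,
      Finset.mem_filter, true_and] at ha ⊢
    rw [good]
    exact ⟨ha.1, (posn_good u v).2 ha.2⟩
  · rintro ⟨z, u, v⟩ ha ⟨z', u', v'⟩ ha' h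
    simp only [Finset.mem_product, Finset.mem_erase, Finset.mem_univ, and_true] at ha
    obtain ⟨rfl, rfl, rfl⟩ := psi_inj ha.1 h
    rfl
  · intro x hx
    simp only [Finset.mem_filter, Finset.mem_univ, true_and] at hx
    have hz : x ⟨k + m, by omega⟩ ≠ 0 := by
      have := ((forall_connSet h1 (by omega) (fun I => ∑ i ∈ I, x i ≠ 0)).1 hx).2 k k le_rfl le_rfl
        (by omega)
      rwa [sum_ivlz (by omega), sum_ivl_self, add_zero] at this
    obtain ⟨u, v, huv⟩ := exists_posn x hz
    refine ⟨(x ⟨k + m, by omega⟩, u, v), ?_, huv⟩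
    rw [← huv, good] at hx
    simp only [Finset.mem_product, Finset.mem_erase, Finset.mem_univ, and_true,
      Finset.mem_filter, true_and]
    exact ⟨hz, (posn_good u v).1 hx.2⟩

theorem prod_eval (a e m : ℕ) :
    ∏ i ∈ Finset.Icc (a + 1) (a + m), (((e + a + m : ℕ) : ℚ) - i) =
      ((m.factorial * e.multichoose m : ℕ) : ℚ) := by
  have h1 : m.factorial * e.multichoose m = e.ascFactorial m := by
    rw [Nat.ascFactorial_eq_factorial_mul_choose', Nat.multichoose_eq]
  rw [h1, Nat.ascFactorial_eq_prod_range]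
  push_cast
  refine Finset.prod_bij' (fun i _ => a + m - i) (fun i _ => a + m - i) ?_ ?_ ?_ ?_ ?_
  · intro i hi; simp only [Finset.mem_Icc, Finset.mem_range] at *; omega
  · intro i hi; simp only [Finset.mem_Icc, Finset.mem_range] at *; omega
  · intro i hi; simp only [Finset.mem_Icc, Finset.mem_range] at *; omega
  · intro i hi; simp only [Finset.mem_Icc, Finset.mem_range] at *; omega
  · intro i hi
    simp only [Finset.mem_Icc] at hi
    rw [Nat.cast_sub hi.2]; push_cast; ring

open Classical in
theorem count_prime {k m e : ℕ} (h1 : 1 < k) (h2 : 0 < m) (he : 0 < e) (p : ℕ) [Fact p.Prime]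
    (hp : p = (e + k + m) + 1) :
    (Finset.univ.filter fun x : Fin (k + m + 1) → ZMod p =>
      ∀ I, ConnSet (pathTriangle (k + m) k) I → ∑ i ∈ I, x i ≠ 0).card =
    (e + k + m) * ((k.factorial * e.multichoose k) * (m.factorial * e.multichoose m)) := by
  refine Eq.trans ?_ ((point_count (F := ZMod p) h1 h2).trans ?_)
  · congr!
  rw [ZMod.card]
  subst hp
  rw [Nat.add_sub_cancel]
  refine congrArg _ (Eq.trans ?_ (labelled_zmod (L := e + k + m) (by omega) k m e he rfl))
  congr!
/-- For `1 < k < n`, the characteristic polynomial of the connected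
subgraph arrangement of the path-with-triangle graph `Δ_{n,k}` is
`(t − 1) · ∏_{i=k+2}^{n+1} (t − i) · ∏_{i=n−k+2}^{n+1} (t − i)`. -/
theorem csa_pathTriangle_charPoly (n k : ℕ) (h1 : 1 < k) (h2 : k < n) :
    charPoly (csaFinset (pathTriangle n k)) =
      (Polynomial.X - 1) *
        (∏ i ∈ Finset.Icc (k + 2) (n + 1), (Polynomial.X - Polynomial.C (i : ℚ))) *
        (∏ i ∈ Finset.Icc (n - k + 2) (n + 1), (Polynomial.X - Polynomial.C (i : ℚ))) := by
  obtain ⟨m, rfl⟩ : ∃ m, n = k + m := ⟨n - k, by omega⟩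
  obtain ⟨c, hc, hev⟩ := charPoly_eval (pathTriangle (k + m) k)
  apply Polynomial.eq_of_infinite_eval_eq
  have hinf : Set.Infinite ((fun p : ℕ => (p : ℚ)) '' {p : ℕ | p.Prime ∧ k + m + 1 + c.natAbs < p}) := by
    apply Set.Infinite.image Nat.cast_injective.injOn
    rw [Set.infinite_iff_exists_gt]
    intro a
    obtain ⟨p, hp, hpp⟩ := Nat.exists_infinite_primes (a + (k + m + 1 + c.natAbs) + 1)
    exact ⟨p, ⟨hpp, by omega⟩, by omega⟩
  refine hinf.mono ?_
  rintro _ ⟨p, ⟨hp, hlt⟩, rfl⟩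
  have : Fact p.Prime := ⟨hp⟩
  have hndvd : ¬ (p : ℤ) ∣ c := by
    intro hd
    have := Nat.le_of_dvd (Int.natAbs_pos.2 hc) (Int.natCast_dvd.1 hd)
    omega
  obtain ⟨e, he, hpe⟩ : ∃ e, 0 < e ∧ p = (e + k + m) + 1 := ⟨p - (k + m + 1), by omega, by omega⟩
  have hcount := (hev p hndvd).trans (congrArg (Nat.cast : ℕ → ℚ)
    (count_prime (k := k) (m := m) h1 (by omega) he p hpe))
  show Polynomial.eval _ _ = Polynomial.eval _ _
  rw [hcount]
  have q1 := prod_eval (k + 1) e m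
  have q2 := prod_eval (m + 1) e k
  have r1 : Finset.Icc (k + 2) (k + m + 1) = Finset.Icc (k + 1 + 1) (k + 1 + m) := by
    congr 1; omega
  have r2 : Finset.Icc (k + m - k + 2) (k + m + 1) = Finset.Icc (m + 1 + 1) (m + 1 + k) := by
    congr 1 <;> omega
  have t1 : e + (k + 1) + m = e + k + m + 1 := by omega
  have t2 : e + (m + 1) + k = e + k + m + 1 := by omega
  rw [t1, ← hpe] at q1
  rw [t2, ← hpe] at q2
  simp only [Polynomial.eval_mul, Polynomial.eval_prod, Polynomial.eval_sub, Polynomial.eval_X,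
    Polynomial.eval_C, Polynomial.eval_one]
  rw [r1, r2, q1, q2]
  have hp1 : (p : ℚ) - 1 = ((e + k + m : ℕ) : ℚ) := by rw [hpe]; push_cast; ring
  rw [hp1]
  push_cast
  ring
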